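/- (One-round FedDyn descent, strongly convex case.) Assume each L_k is μ-strongly convex for some μ > 0 and α ≥ max( 5·(m/P)·μ , 30·L ). Set z = α³P + α²Pμ − α²mμ − 20αL²P + 4L²mμ − 20L²Pμ, κ = 8m(L + α)/z, κ₀ = ( 2α³P + 2α²Pμ − 2α²mμ − 40α²LP − 80αL²P − 40αLPμ + 8αLmμ + 16L²mμ − 80L²Pμ ) / (α·z), and r = 1 + μ/α. Then r·( E_𝒫[ ‖γ(𝒫) − θ*‖² ] + κ · E_𝒫[ C⁺(𝒫) ] ) ≤ ‖γ̄ − θ*‖² + κ·C − κ₀·( ℓ(γ̄) − ℓ(θ*) ). -/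

import Mathlib

open scoped RealInnerProductSpace

section Helpers

variable {E : Type*} [NormedAddCommGroup E] [InnerProductSpace ℝ E]

lemma fd_descent [CompleteSpace E] (f : E → ℝ) (L : ℝ) (hf : Differentiable ℝ f)
    (hs : ∀ x y, ‖gradient f x - gradient f y‖ ≤ L * ‖x - y‖) (x y : E) :
    f y ≤ f x + ⟪gradient f x, y - x⟫ + L / 2 * ‖y - x‖ ^ 2 := by
  set v := y - x with hv
  have hd : ∀ t : ℝ, HasDerivAt
      (fun t : ℝ => f (x + t • v) - t * ⟪gradient f x, v⟫ - t ^ 2 * (L / 2 * ‖v‖ ^ 2))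
      (⟪gradient f (x + t • v), v⟫ - ⟪gradient f x, v⟫ - (2 * t) * (L / 2 * ‖v‖ ^ 2)) t := by
    intro t
    have h1 : HasDerivAt (fun t : ℝ => x + t • v) v t := by
      simpa using ((hasDerivAt_id t).smul_const v).const_add x
    have h2 := (hf (x + t • v)).hasGradientAt.hasFDerivAt.comp_hasDerivAt t h1
    have h3 : HasDerivAt (fun t : ℝ => f (x + t • v)) ⟪gradient f (x + t • v), v⟫ t := h2
    have h4 : HasDerivAt (fun t : ℝ => t * ⟪gradient f x, v⟫) ⟪gradient f x, v⟫ t := by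
      simpa using (hasDerivAt_id t).mul_const ⟪gradient f x, v⟫
    have h5 : HasDerivAt (fun t : ℝ => t ^ 2 * (L / 2 * ‖v‖ ^ 2))
        ((2 * t) * (L / 2 * ‖v‖ ^ 2)) t := by
      simpa using (hasDerivAt_pow 2 t).mul_const (L / 2 * ‖v‖ ^ 2)
    exact (h3.sub h4).sub h5
  have hanti := antitoneOn_of_deriv_nonpos (convex_Icc (0 : ℝ) 1)
    (fun t _ => (hd t).continuousAt.continuousWithinAt)
    (fun t _ => (hd t).differentiableAt.differentiableWithinAt)
    (by
      intro t ht
      rw [interior_Icc] at ht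
      rw [(hd t).deriv, ← inner_sub_left]
      have h1 := real_inner_le_norm (gradient f (x + t • v) - gradient f x) v
      have h2 := hs (x + t • v) x
      have h3 : ‖x + t • v - x‖ = t * ‖v‖ := by
        rw [add_sub_cancel_left, norm_smul, Real.norm_of_nonneg ht.1.le]
      rw [h3] at h2
      have h4 := mul_le_mul_of_nonneg_right h2 (norm_nonneg v)
      nlinarith)
  have := hanti (Set.left_mem_Icc.2 zero_le_one) (Set.right_mem_Icc.2 zero_le_one) zero_le_one
  have hxy : x + v = y := by rw [hv]; abel
  simp only [one_smul, zero_smul, hxy, add_zero, one_mul, zero_mul, one_pow, sub_zero,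
    ne_eq, OfNat.ofNat_ne_zero, not_false_eq_true, zero_pow] at this
  linarith

lemma fd_coco [CompleteSpace E] (f : E → ℝ) (L : ℝ) (hL : 0 < L) (hf : Differentiable ℝ f)
    (hc : ∀ x y, f x + ⟪gradient f x, y - x⟫ ≤ f y)
    (hs : ∀ x y, ‖gradient f x - gradient f y‖ ≤ L * ‖x - y‖) (x y : E) :
    ‖gradient f x - gradient f y‖ ^ 2 ≤
      2 * L * (f x - f y - ⟪gradient f y, x - y⟫) := by
  set w := gradient f x - gradient f y with hw
  have h1 := fd_descent f L hf hs x (x - L⁻¹ • w)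
  have h2 := hc y (x - L⁻¹ • w)
  have e1 : x - L⁻¹ • w - x = -(L⁻¹ • w) := by abel
  have e2 : x - L⁻¹ • w - y = (x - y) - L⁻¹ • w := by abel
  rw [e1, norm_neg, norm_smul, inner_neg_right, inner_smul_right, Real.norm_of_nonneg
    (by positivity)] at h1
  rw [e2, inner_sub_right, inner_smul_right] at h2
  have h3 : ‖w‖ ^ 2 = ⟪gradient f x, w⟫ - ⟪gradient f y, w⟫ := by
    rw [← inner_sub_left, ← hw, real_inner_self_eq_norm_sq]
  have h4 : L / 2 * (L⁻¹ * ‖w‖) ^ 2 = L⁻¹ * ‖w‖ ^ 2 / 2 := by field_simp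
  rw [h4] at h1
  have h5 : L⁻¹ * ‖w‖ ^ 2 = L⁻¹ * ⟪gradient f x, w⟫ - L⁻¹ * ⟪gradient f y, w⟫ := by
    rw [h3]; ring
  have h6 : L⁻¹ * ‖w‖ ^ 2 / 2 ≤ f x - f y - ⟪gradient f y, x - y⟫ := by linarith
  have h7 := mul_le_mul_of_nonneg_left h6 (by positivity : 0 ≤ 2 * L)
  have h8 : 2 * L * (L⁻¹ * ‖w‖ ^ 2 / 2) = ‖w‖ ^ 2 := by field_simp
  linarith

lemma fd_jensen {ι : Type*} (s : Finset ι) (f : ι → E) (n : ℕ) (hn : 1 ≤ n) (hs : s.card = n)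
    (a : E) :
    ‖(n : ℝ)⁻¹ • ∑ k ∈ s, f k - a‖ ^ 2 ≤ (n : ℝ)⁻¹ * ∑ k ∈ s, ‖f k - a‖ ^ 2 := by
  have hn' : (0 : ℝ) < n := by exact_mod_cast hn
  have e : (n : ℝ)⁻¹ • ∑ k ∈ s, f k - a = (n : ℝ)⁻¹ • ∑ k ∈ s, (f k - a) := by
    rw [Finset.sum_sub_distrib, Finset.sum_const, hs, smul_sub, ← Nat.cast_smul_eq_nsmul ℝ,
      smul_smul, inv_mul_cancel₀ hn'.ne', one_smul]
  rw [e, norm_smul, Real.norm_of_nonneg (by positivity), mul_pow]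
  have h1 : ‖∑ k ∈ s, (f k - a)‖ ^ 2 ≤ n * ∑ k ∈ s, ‖f k - a‖ ^ 2 := by
    calc _ ≤ (∑ k ∈ s, ‖f k - a‖) ^ 2 := by gcongr; exact norm_sum_le _ _
      _ ≤ _ := by rw [← hs]; exact sq_sum_le_card_mul_sum_sq
  calc _ ≤ ((n : ℝ)⁻¹) ^ 2 * (n * ∑ k ∈ s, ‖f k - a‖ ^ 2) := by gcongr
    _ = _ := by field_simp

lemma fd_comb (m P : ℕ) (hP1 : 1 ≤ P) (hPm : P ≤ m) (f : Fin m → ℝ) :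
    (∑ S ∈ Finset.powersetCard P (Finset.univ : Finset (Fin m)), ∑ k ∈ S, f k) /
      ((Finset.powersetCard P (Finset.univ : Finset (Fin m))).card : ℝ) =
    (P : ℝ) * ((m : ℝ)⁻¹ * ∑ k, f k) := by
  have hc : ∀ k : Fin m, ((Finset.powersetCard P (Finset.univ : Finset (Fin m))).filter
      (fun S => k ∈ S)).card = (m - 1).choose (P - 1) := by
    intro k
    have := Finset.card_filter_powersetCard_subset {k} (Finset.univ : Finset (Fin m)) P
      (by simp) (by simpa using hP1)
    simpa using this
  have h1 : ∑ S ∈ Finset.powersetCard P (Finset.univ : Finset (Fin m)), ∑ k ∈ S, f k =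
      ∑ k, ((m - 1).choose (P - 1) : ℝ) * f k := by
    have : ∀ S : Finset (Fin m), ∑ k ∈ S, f k = ∑ k, if k ∈ S then f k else 0 := by
      intro S; simp
    simp_rw [this]
    rw [Finset.sum_comm]
    refine Finset.sum_congr rfl fun k _ => ?_
    rw [← Finset.sum_filter, Finset.sum_const, hc, nsmul_eq_mul]
  rw [h1, ← Finset.mul_sum, Finset.card_powersetCard, Finset.card_univ, Fintype.card_fin]
  obtain ⟨m, rfl⟩ : ∃ n, m = n + 1 := ⟨m - 1, by omega⟩
  obtain ⟨P, rfl⟩ : ∃ n, P = n + 1 := ⟨P - 1, by omega⟩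
  have h2 := Nat.add_one_mul_choose_eq m P
  have h3 : ((m + 1 : ℕ) : ℝ) * (m.choose P : ℝ) = ((m + 1).choose (P + 1) : ℝ) * ((P + 1 : ℕ) : ℝ) := by
    exact_mod_cast h2
  have h4 : (0 : ℝ) < ((m + 1).choose (P + 1) : ℝ) := by
    exact_mod_cast Nat.choose_pos hPm
  have h5 : (0 : ℝ) < ((m + 1 : ℕ) : ℝ) := by positivity
  simp only [Nat.add_sub_cancel]
  rw [div_eq_iff h4.ne']
  field_simp
  linear_combination (∑ k, f k) * h3

lemma fd_scalar (m P α L μ z κ κ₀ r Eγ Q A ε U C D : ℝ)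
    (hm : 0 < m) (hP : 0 < P) (hPm : P ≤ m) (hα : 0 < α) (hL : 0 < L) (hμ : 0 < μ)
    (h5 : 5 * m * μ ≤ α * P) (h30 : 30 * L ≤ α)
    (hz : z = α ^ 3 * P + α ^ 2 * P * μ - α ^ 2 * m * μ - 20 * α * L ^ 2 * P +
      4 * L ^ 2 * m * μ - 20 * L ^ 2 * P * μ)
    (hκ : κ = 8 * m * (L + α) / z)
    (hκ₀ : κ₀ = (2 * α ^ 3 * P + 2 * α ^ 2 * P * μ - 2 * α ^ 2 * m * μ -
      40 * α ^ 2 * L * P - 80 * α * L ^ 2 * P - 40 * α * L * P * μ +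
      8 * α * L * m * μ + 16 * L ^ 2 * m * μ - 80 * L ^ 2 * P * μ) / (α * z))
    (hr : r = 1 + μ / α)
    (hE : Eγ ≤ Q) (hQ : (α + μ) * Q ≤ α * A - 2 * D + (L + α) * ε)
    (hε : α ^ 2 * ε ≤ 8 * C + 2 * U) (hU : U ≤ 2 * L ^ 2 * ε + 4 * L * D) :
    r * (Eγ + κ * (C - P * (m⁻¹ * C) + P * (m⁻¹ * U))) ≤ A + κ * C - κ₀ * D := by
  have hLL : 900 * L ^ 2 ≤ α ^ 2 := by nlinarith
  have hz0 : 0 < z := by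
    have a1 : 900 * L ^ 2 * ((α + μ) * P) ≤ α ^ 2 * ((α + μ) * P) :=
      mul_le_mul_of_nonneg_right hLL (by positivity)
    have a2 : α ^ 2 * (5 * m * μ) ≤ α ^ 2 * (α * P) :=
      mul_le_mul_of_nonneg_left h5 (by positivity)
    have a3 : 0 < α ^ 2 * (α * P) := by positivity
    have a4 : 0 < α ^ 2 * (μ * P) := by positivity
    have a5 : 0 < L ^ 2 * m * μ := by positivity
    rw [hz]; nlinarith
  have hκ0 : 0 < κ := by rw [hκ]; positivity
  -- multipliers
  obtain ⟨b, hb⟩ : ∃ b, b = κ * ((α + μ) * P - μ * m) / (8 * (α * m)) := ⟨_, rfl⟩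
  obtain ⟨c, hc⟩ : ∃ c, c = κ * (5 * (α + μ) * P - μ * m) / (4 * (α * m)) := ⟨_, rfl⟩
  have hb0 : 0 ≤ b := by
    rw [hb]
    have : 0 ≤ (α + μ) * P - μ * m := by nlinarith [mul_pos hμ hP, mul_pos hμ hm]
    positivity
  have hc0 : 0 ≤ c := by
    rw [hc]
    have : 0 ≤ 5 * (α + μ) * P - μ * m := by nlinarith [mul_pos hμ hP, mul_pos hμ hm, mul_pos hα hP]
    positivity
  have i1 : (L + α) / α + 2 * L ^ 2 * c = b * α ^ 2 := by
    rw [hb, hc, hκ]; field_simp; rw [hz]; ring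
  have i2 : κ₀ = 2 / α - 4 * L * c := by
    rw [hκ₀, hc, hκ]; field_simp; rw [hz]; ring
  have i3 : r * κ * (1 - P * m⁻¹) + 8 * b = κ := by
    rw [hb, hr]; field_simp; ring
  have i4 : r * κ * (P * m⁻¹) + 2 * b = c := by
    rw [hb, hc, hr]; field_simp; ring
  have j1 : r * Eγ ≤ A - 2 / α * D + (L + α) / α * ε := by
    have t1 : r * Eγ ≤ r * Q := mul_le_mul_of_nonneg_left hE (by rw [hr]; positivity)
    have t2 : r * Q = (α + μ) * Q / α := by rw [hr]; field_simp
    have t3 : (α + μ) * Q / α ≤ (α * A - 2 * D + (L + α) * ε) / α := by gcongr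
    have t4 : (α * A - 2 * D + (L + α) * ε) / α = A - 2 / α * D + (L + α) / α * ε := by
      field_simp
    linarith
  have j2 := mul_le_mul_of_nonneg_left hε hb0
  have j3 := mul_le_mul_of_nonneg_left hU hc0
  have k1 : r * (κ * (C - P * (m⁻¹ * C) + P * (m⁻¹ * U))) = (κ - 8 * b) * C + (c - 2 * b) * U := by
    rw [← i4]; nth_rewrite 2 [← i3]; ring
  have k2 : (L + α) / α * ε = b * α ^ 2 * ε - 2 * L ^ 2 * c * ε := by rw [← i1]; ring
  rw [i2, mul_add, k1]
  linarith

lemma fd_two (a b : E) : ‖a + b‖ ^ 2 ≤ 2 * ‖a‖ ^ 2 + 2 * ‖b‖ ^ 2 := by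
  have := parallelogram_law_with_norm ℝ a b
  nlinarith [sq_nonneg ‖a - b‖]

end Helpers

/-- one-round FedDyn descent, strongly convex case. -/
theorem one_round_descent_strongly_convex
    (d m P : ℕ) (hd : 1 ≤ d) (hm : 1 ≤ m) (hP1 : 1 ≤ P) (hPm : P ≤ m)
    (α L μ : ℝ) (hα : 0 < α) (hL : 0 < L) (hμ : 0 < μ)
    (hαc : max (5 * ((m : ℝ) / P) * μ) (30 * L) ≤ α)
    (Lk : Fin m → EuclideanSpace ℝ (Fin d) → ℝ)
    (hdiff : ∀ k, Differentiable ℝ (Lk k))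
    (hsc : ∀ k x y, Lk k x + ⟪gradient (Lk k) x, y - x⟫ + μ / 2 * ‖y - x‖ ^ 2 ≤ Lk k y)
    (hsmooth : ∀ k x y, ‖gradient (Lk k) x - gradient (Lk k) y‖ ≤ L * ‖x - y‖)
    (ℓ : EuclideanSpace ℝ (Fin d) → ℝ)
    (hℓ : ∀ θ, ℓ θ = (m : ℝ)⁻¹ * ∑ k, Lk k θ)
    (θstar : EuclideanSpace ℝ (Fin d)) (hmin : ∀ θ, ℓ θstar ≤ ℓ θ)
    (θbar : EuclideanSpace ℝ (Fin d))
    (g : Fin m → EuclideanSpace ℝ (Fin d))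
    (h : EuclideanSpace ℝ (Fin d)) (hh : h = (m : ℝ)⁻¹ • ∑ k, g k)
    (γbar : EuclideanSpace ℝ (Fin d)) (hγbar : γbar = θbar + α⁻¹ • h)
    (θt : Fin m → EuclideanSpace ℝ (Fin d))
    (hfoc : ∀ k, gradient (Lk k) (θt k) - g k + α • (θt k - θbar) = 0)
    (z κ κ₀ r : ℝ)
    (hz : z = α ^ 3 * P + α ^ 2 * P * μ - α ^ 2 * m * μ - 20 * α * L ^ 2 * P +
      4 * L ^ 2 * m * μ - 20 * L ^ 2 * P * μ)
    (hκ : κ = 8 * m * (L + α) / z)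
    (hκ₀ : κ₀ = (2 * α ^ 3 * P + 2 * α ^ 2 * P * μ - 2 * α ^ 2 * m * μ -
      40 * α ^ 2 * L * P - 80 * α * L ^ 2 * P - 40 * α * L * P * μ +
      8 * α * L * m * μ + 16 * L ^ 2 * m * μ - 80 * L ^ 2 * P * μ) / (α * z))
    (hr : r = 1 + μ / α) :
    r * ((∑ S ∈ Finset.powersetCard P (Finset.univ : Finset (Fin m)),
        ‖(P : ℝ)⁻¹ • ∑ k ∈ S, θt k - θstar‖ ^ 2) /
      ((Finset.powersetCard P (Finset.univ : Finset (Fin m))).card : ℝ) +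
    κ * ((∑ S ∈ Finset.powersetCard P (Finset.univ : Finset (Fin m)),
        (m : ℝ)⁻¹ * (∑ k ∈ S, ‖gradient (Lk k) (θt k) - gradient (Lk k) θstar‖ ^ 2 +
          ∑ k ∈ Sᶜ, ‖g k - gradient (Lk k) θstar‖ ^ 2)) /
      ((Finset.powersetCard P (Finset.univ : Finset (Fin m))).card : ℝ))) ≤
    ‖γbar - θstar‖ ^ 2 +
      κ * ((m : ℝ)⁻¹ * ∑ k, ‖g k - gradient (Lk k) θstar‖ ^ 2) -
      κ₀ * (ℓ γbar - ℓ θstar) := by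
  have hm' : (0 : ℝ) < m := by exact_mod_cast hm
  have hP' : (0 : ℝ) < P := by exact_mod_cast hP1
  have hPm' : (P : ℝ) ≤ m := by exact_mod_cast hPm
  have h30 : 30 * L ≤ α := le_trans (le_max_right _ _) hαc
  have h5 : 5 * (m : ℝ) * μ ≤ α * P := by
    have := le_trans (le_max_left _ _) hαc
    have h2 := mul_le_mul_of_nonneg_right this hP'.le
    have h3 : 5 * ((m : ℝ) / P) * μ * P = 5 * (m : ℝ) * μ := by field_simp
    linarith
  -- optimality of `θstar`
  have hgrad : ∑ k, gradient (Lk k) θstar = 0 := by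
    have hF : HasFDerivAt (fun θ => ∑ k, Lk k θ)
        (∑ k, (InnerProductSpace.toDual ℝ _ (gradient (Lk k) θstar))) θstar :=
      HasFDerivAt.fun_sum fun k _ => (hdiff k θstar).hasGradientAt.hasFDerivAt
    have hmn : IsLocalMin (fun θ => ∑ k, Lk k θ) θstar := by
      refine Filter.Eventually.of_forall fun θ => ?_
      have := hmin θ
      rw [hℓ, hℓ] at this
      exact le_of_mul_le_mul_left this (by positivity)
    have h0 := hmn.hasFDerivAt_eq_zero hF
    rw [← map_sum] at h0
    exact (map_eq_zero_iff _ (InnerProductSpace.toDual ℝ _).injective).1 h0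
  set cn : ℝ := ((Finset.powersetCard P (Finset.univ : Finset (Fin m))).card : ℝ) with hcn
  have hcn0 : 0 < cn := by
    rw [hcn, Finset.card_powersetCard, Finset.card_univ, Fintype.card_fin]
    exact_mod_cast Nat.choose_pos hPm
  have hconst : ∀ x : ℝ, (m : ℝ)⁻¹ * ∑ _k : Fin m, x = x := by
    intro x; simp; field_simp
  -- rewrite the expectation of `C⁺`
  have hC : (∑ S ∈ Finset.powersetCard P (Finset.univ : Finset (Fin m)),
        (m : ℝ)⁻¹ * (∑ k ∈ S, ‖gradient (Lk k) (θt k) - gradient (Lk k) θstar‖ ^ 2 +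
          ∑ k ∈ Sᶜ, ‖g k - gradient (Lk k) θstar‖ ^ 2)) / cn =
      (m : ℝ)⁻¹ * ∑ k, ‖g k - gradient (Lk k) θstar‖ ^ 2
       - P * ((m : ℝ)⁻¹ * ((m : ℝ)⁻¹ * ∑ k, ‖g k - gradient (Lk k) θstar‖ ^ 2))
       + P * ((m : ℝ)⁻¹ * ((m : ℝ)⁻¹ *
          ∑ k, ‖gradient (Lk k) (θt k) - gradient (Lk k) θstar‖ ^ 2)) := by
    have e1 := fd_comb m P hP1 hPm
      (fun k => ‖gradient (Lk k) (θt k) - gradient (Lk k) θstar‖ ^ 2)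
    have e2 := fd_comb m P hP1 hPm (fun k => ‖g k - gradient (Lk k) θstar‖ ^ 2)
    rw [← hcn, div_eq_iff hcn0.ne'] at e1 e2
    have e3 : ∀ S : Finset (Fin m), ∑ k ∈ Sᶜ, ‖g k - gradient (Lk k) θstar‖ ^ 2 =
        ∑ k, ‖g k - gradient (Lk k) θstar‖ ^ 2 - ∑ k ∈ S, ‖g k - gradient (Lk k) θstar‖ ^ 2 := by
      intro S
      rw [← Finset.sum_add_sum_compl S]; ring
    simp_rw [e3]
    rw [← Finset.mul_sum, Finset.sum_add_distrib, Finset.sum_sub_distrib, e1, e2,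
      Finset.sum_const, nsmul_eq_mul, ← hcn, div_eq_iff hcn0.ne']
    ring
  -- Jensen
  have hE : (∑ S ∈ Finset.powersetCard P (Finset.univ : Finset (Fin m)),
        ‖(P : ℝ)⁻¹ • ∑ k ∈ S, θt k - θstar‖ ^ 2) / cn ≤
      (m : ℝ)⁻¹ * ∑ k, ‖θt k - θstar‖ ^ 2 := by
    have e1 := fd_comb m P hP1 hPm (fun k => ‖θt k - θstar‖ ^ 2)
    rw [← hcn, div_eq_iff hcn0.ne'] at e1
    rw [div_le_iff₀ hcn0]
    calc _ ≤ ∑ S ∈ Finset.powersetCard P (Finset.univ : Finset (Fin m)),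
          (P : ℝ)⁻¹ * ∑ k ∈ S, ‖θt k - θstar‖ ^ 2 := by
          refine Finset.sum_le_sum fun S hS => ?_
          exact fd_jensen S θt P hP1 (Finset.mem_powersetCard.1 hS).2 θstar
      _ = _ := by
          rw [← Finset.mul_sum, e1]; field_simp
  have hh' : ∑ k, g k = (m : ℝ) • h := by
    rw [hh, smul_smul, mul_inv_cancel₀ hm'.ne', one_smul]
  have hdiffk : ∀ k, α • (θt k - γbar) = g k - gradient (Lk k) (θt k) - h := by
    intro k
    have h1 := hfoc k
    have h2 : α • (θt k - γbar) = α • (θt k - θbar) - h := by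
      rw [hγbar, ← sub_sub, smul_sub _ _ (α⁻¹ • h), smul_smul, mul_inv_cancel₀ hα.ne', one_smul]
    rw [h2, eq_neg_of_add_eq_zero_right h1]
    abel
  rw [hC]
  refine fd_scalar m P α L μ z κ κ₀ r _ ((m : ℝ)⁻¹ * ∑ k, ‖θt k - θstar‖ ^ 2) _
    ((m : ℝ)⁻¹ * ∑ k, ‖θt k - γbar‖ ^ 2) _ _ _ hm' hP' hPm' hα hL hμ h5 h30 hz hκ hκ₀ hr hE
    ?_ ?_ ?_
  · -- main descent
    have hk : ∀ k, (α + μ) * ‖θt k - θstar‖ ^ 2 ≤ α * ‖γbar - θstar‖ ^ 2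
        - 2 * (Lk k γbar - Lk k θstar) + (L + α) * ‖θt k - γbar‖ ^ 2
        + 2 * ⟪γbar - θstar, g k - h⟫ := by
      intro k
      have a1 := hsc k (θt k) θstar
      have a2 := fd_descent (Lk k) L (hdiff k) (hsmooth k) (θt k) γbar
      have a3 : ‖θt k - θstar‖ ^ 2 = ‖γbar - θstar‖ ^ 2 + 2 * ⟪γbar - θstar, θt k - γbar⟫
          + ‖θt k - γbar‖ ^ 2 := by
        rw [← norm_add_sq_real]; congr 2; abel
      have a4 : α * ⟪γbar - θstar, θt k - γbar⟫ = ⟪γbar - θstar, g k - h⟫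
          - (⟪gradient (Lk k) (θt k), γbar - θt k⟫ - ⟪gradient (Lk k) (θt k), θstar - θt k⟫) := by
        rw [← inner_smul_right, hdiffk, ← inner_sub_right, sub_sub_sub_cancel_right,
          real_inner_comm (γbar - θstar) (gradient (Lk k) (θt k)), ← inner_sub_right]
        congr 1; abel
      rw [norm_sub_rev] at a1
      rw [norm_sub_rev γbar] at a2
      have a5 : α * ‖θt k - θstar‖ ^ 2 = α * ‖γbar - θstar‖ ^ 2
          + 2 * (α * ⟪γbar - θstar, θt k - γbar⟫) + α * ‖θt k - γbar‖ ^ 2 := by rw [a3]; ring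
      rw [a4] at a5
      linarith
    have hs := mul_le_mul_of_nonneg_left (Finset.sum_le_sum fun k (_ : k ∈ Finset.univ) => hk k)
      (inv_nonneg.2 hm'.le)
    have e0 : ∑ k, ⟪γbar - θstar, g k - h⟫ = 0 := by
      rw [← inner_sum, Finset.sum_sub_distrib, hh']
      simp [← Nat.cast_smul_eq_nsmul ℝ]
    simp only [Finset.sum_add_distrib, Finset.sum_sub_distrib, ← Finset.mul_sum, e0, mul_add,
      mul_sub] at hs
    have e1 := hconst (‖γbar - θstar‖ ^ 2)
    rw [hℓ, hℓ]
    have e2 : (m : ℝ)⁻¹ * (α * ∑ _k : Fin m, ‖γbar - θstar‖ ^ 2) = α * ‖γbar - θstar‖ ^ 2 := by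
      rw [mul_left_comm, e1]
    linarith
  · -- bound on the client drift
    set cb : EuclideanSpace ℝ (Fin d) := h with hcb
    have hk : ∀ k, α ^ 2 * ‖θt k - γbar‖ ^ 2 ≤ 4 * ‖g k - gradient (Lk k) θstar‖ ^ 2
        + 4 * ‖h‖ ^ 2 + 2 * ‖gradient (Lk k) (θt k) - gradient (Lk k) θstar‖ ^ 2 := by
      intro k
      have a1 : α ^ 2 * ‖θt k - γbar‖ ^ 2 = ‖α • (θt k - γbar)‖ ^ 2 := by
        rw [norm_smul, mul_pow, Real.norm_of_nonneg hα.le]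
      have a2 : g k - gradient (Lk k) (θt k) - h = ((g k - gradient (Lk k) θstar) + -h)
          + -(gradient (Lk k) (θt k) - gradient (Lk k) θstar) := by abel
      rw [a1, hdiffk, a2]
      have a3 := fd_two ((g k - gradient (Lk k) θstar) + -h)
        (-(gradient (Lk k) (θt k) - gradient (Lk k) θstar))
      have a4 := fd_two (g k - gradient (Lk k) θstar) (-h)
      rw [norm_neg] at a3 a4
      linarith
    have hs := mul_le_mul_of_nonneg_left (Finset.sum_le_sum fun k (_ : k ∈ Finset.univ) => hk k)
      (inv_nonneg.2 hm'.le)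
    have hj := fd_jensen Finset.univ (fun k => g k - gradient (Lk k) θstar) m hm (by simp) 0
    rw [Finset.sum_sub_distrib, hgrad] at hj
    simp only [sub_zero] at hj
    rw [← hh] at hj
    have e2 := hconst (4 * ‖h‖ ^ 2)
    simp only [Finset.sum_add_distrib, mul_add] at hs
    rw [e2] at hs
    simp only [← Finset.mul_sum] at hs
    linarith
  · have hk : ∀ k, ‖gradient (Lk k) (θt k) - gradient (Lk k) θstar‖ ^ 2 ≤
        2 * L ^ 2 * ‖θt k - γbar‖ ^ 2 + 4 * L * (Lk k γbar - Lk k θstar)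
          - 4 * L * ⟪gradient (Lk k) θstar, γbar - θstar⟫ := by
      intro k
      have a1 := fd_coco (Lk k) L hL (hdiff k) (fun x y => by
        have := hsc k x y
        have h0 : 0 ≤ μ / 2 * ‖y - x‖ ^ 2 := by positivity
        linarith) (hsmooth k) γbar θstar
      have a2 := fd_two (gradient (Lk k) (θt k) - gradient (Lk k) γbar)
        (gradient (Lk k) γbar - gradient (Lk k) θstar)
      rw [sub_add_sub_cancel] at a2
      have a3 := pow_le_pow_left₀ (norm_nonneg _) (hsmooth k (θt k) γbar) 2
      rw [mul_pow] at a3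
      linarith
    have hs := mul_le_mul_of_nonneg_left (Finset.sum_le_sum fun k (_ : k ∈ Finset.univ) => hk k)
      (inv_nonneg.2 hm'.le)
    have e0 : ∑ k, ⟪gradient (Lk k) θstar, γbar - θstar⟫ = 0 := by
      rw [← sum_inner, hgrad, inner_zero_left]
    simp only [Finset.sum_add_distrib, Finset.sum_sub_distrib, ← Finset.mul_sum, e0, mul_add,
      mul_sub] at hs
    rw [hℓ, hℓ]
    linarith
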